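/- arXiv:2605.04792 — 2 statements merged into one kernel-verified Lean document; each statement's English description precedes it below -/
import Mathlib

section
/- For every real k > 1, the sum over all quadratic fields F of |𝒟_F|^{−k}·∏_{p ∣ 𝒟_F} (p+1)/(p²+p+1) equals (1 + 3/(7·4^{k}) + 6/(7·8^{k}))·∏_{p odd prime} (1 + (p+1)/(p^{k}(p²+p+1))) − 1. -/
/- STATEMENT 4: For k > 1, the sum over all quadratic fields F of
|𝒟_F|^{−k}·∏_{p ∣ 𝒟_F} (p+1)/(p²+p+1) equals
(1 + 3/(7·4^k) + 6/(7·8^k))·∏_{p odd prime} (1 + (p+1)/(p^k(p²+p+1))) − 1. -/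

open scoped Classical
noncomputable section

/-- The discriminant of the quadratic field ℚ(√r), for r squarefree. -/
def quadDisc (r : ℤ) : ℤ := if r % 4 = 1 then r else 4 * r

/-- The local factor `(p + 1) / (p² + p + 1)`. -/
def localWeight (p : ℕ) : ℝ := ((p : ℝ) + 1) / ((p : ℝ) ^ 2 + p + 1)

/-- The term `n ^ (-k) * ∏ p ∣ n, (p + 1) / (p² + p + 1)`. -/
def discWeight (k : ℝ) (n : ℕ) : ℝ := (n : ℝ) ^ (-k) * ∏ p ∈ n.primeFactors, localWeight p

/-- The restriction of `discWeight k` to odd squarefree integers. -/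
def oddWeight (k : ℝ) (n : ℕ) : ℝ := if Odd n ∧ Squarefree n then discWeight k n else 0

/-- The weight of the discriminant attached to a squarefree integer, and `0` otherwise. -/
def fieldWeight (k : ℝ) (r : ℤ) : ℝ :=
  if Squarefree r then discWeight k (quadDisc r).natAbs else 0

lemma localWeight_nonneg (p : ℕ) : 0 ≤ localWeight p := by
  unfold localWeight; positivity

lemma localWeight_le_one (p : ℕ) : localWeight p ≤ 1 := by
  unfold localWeight
  rw [div_le_one (by positivity)]
  nlinarith [sq_nonneg (p : ℝ)]

lemma discWeight_nonneg (k : ℝ) (n : ℕ) : 0 ≤ discWeight k n :=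
  mul_nonneg (by positivity) (Finset.prod_nonneg fun p _ => localWeight_nonneg p)

lemma discWeight_le (k : ℝ) (n : ℕ) : discWeight k n ≤ (n : ℝ) ^ (-k) :=
  mul_le_of_le_one_right (by positivity)
    (Finset.prod_le_one (fun p _ => localWeight_nonneg p) fun p _ => localWeight_le_one p)

lemma discWeight_mul (k : ℝ) {m n : ℕ} (h : m.Coprime n) :
    discWeight k (m * n) = discWeight k m * discWeight k n := by
  unfold discWeight
  rw [h.primeFactors_mul, Finset.prod_union h.disjoint_primeFactors, Nat.cast_mul,
    Real.mul_rpow (by positivity) (by positivity)]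
  ring

lemma discWeight_one (k : ℝ) : discWeight k 1 = 1 := by simp [discWeight]

lemma discWeight_prime (k : ℝ) {p : ℕ} (hp : p.Prime) :
    discWeight k p = (p : ℝ) ^ (-k) * localWeight p := by
  simp [discWeight, hp.primeFactors]

lemma localWeight_two : localWeight 2 = 3 / 7 := by norm_num [localWeight]

lemma discWeight_four (k : ℝ) : discWeight k 4 = 3 / (7 * (4 : ℝ) ^ k) := by
  have h : (4 : ℕ).primeFactors = {2} :=
    Nat.primeFactors_prime_pow (k := 2) two_ne_zero Nat.prime_two
  rw [discWeight, h, Finset.prod_singleton, localWeight_two, Nat.cast_ofNat,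
    Real.rpow_neg (by norm_num)]
  field_simp

lemma discWeight_eight (k : ℝ) : discWeight k 8 = 3 / (7 * (8 : ℝ) ^ k) := by
  have h : (8 : ℕ).primeFactors = {2} :=
    Nat.primeFactors_prime_pow (k := 3) three_ne_zero Nat.prime_two
  rw [discWeight, h, Finset.prod_singleton, localWeight_two, Nat.cast_ofNat,
    Real.rpow_neg (by norm_num)]
  field_simp

lemma oddWeight_one (k : ℝ) : oddWeight k 1 = 1 := by simp [oddWeight, discWeight_one]

lemma oddWeight_nonneg (k : ℝ) (n : ℕ) : 0 ≤ oddWeight k n := by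
  unfold oddWeight
  split_ifs
  exacts [discWeight_nonneg k n, le_rfl]

lemma summable_oddWeight {k : ℝ} (hk : 1 < k) : Summable (oddWeight k) := by
  refine Summable.of_nonneg_of_le (oddWeight_nonneg k) (fun n => ?_)
    (Real.summable_nat_rpow.mpr (neg_lt_neg hk))
  unfold oddWeight
  split_ifs
  exacts [discWeight_le k n, by positivity]

lemma oddWeight_mul (k : ℝ) {m n : ℕ} (h : m.Coprime n) :
    oddWeight k (m * n) = oddWeight k m * oddWeight k n := by
  simp only [oddWeight, Nat.odd_mul, Nat.squarefree_mul h, ite_zero_mul_ite_zero,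
    discWeight_mul k h]
  exact if_congr (by tauto) rfl rfl

lemma tsum_oddWeight_pow (k : ℝ) {p : ℕ} (hp : p.Prime) :
    ∑' e, oddWeight k (p ^ e) = if p = 2 then 1 else 1 + discWeight k p := by
  rw [tsum_eq_sum (s := Finset.range 2) fun e he => ?_]
  · rw [Finset.sum_range_succ, Finset.sum_range_one, pow_zero, pow_one, oddWeight_one]
    split_ifs with h
    · subst h
      simp [oddWeight]
    · rw [oddWeight, if_pos ⟨hp.odd_of_ne_two h, hp.prime.squarefree⟩]
  · rw [Finset.mem_range, not_lt] at he
    refine if_neg fun h => ?_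
    have := ((Nat.squarefree_pow_iff hp.ne_one (by omega)).mp h.2).2
    omega

lemma tsum_oddWeight {k : ℝ} (hk : 1 < k) :
    ∑' n, oddWeight k n = ∏' p : {p : ℕ // p.Prime ∧ p ≠ 2},
      (1 + ((p : ℝ) + 1) / ((p : ℝ) ^ k * ((p : ℝ) ^ 2 + p + 1))) := by
  have heuler := EulerProduct.eulerProduct_hasProd (oddWeight_one k) (fun h => oddWeight_mul k h)
    (summable_oddWeight hk).norm (by simp [oddWeight])
  rw [← heuler.tprod_eq]
  have hl := tprod_subtype {p : ℕ | p.Prime} fun p => ∑' e, oddWeight k (p ^ e)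
  have hr := tprod_subtype {p : ℕ | p.Prime ∧ p ≠ 2} fun p =>
    (1 + ((p : ℝ) + 1) / ((p : ℝ) ^ k * ((p : ℝ) ^ 2 + p + 1)))
  refine hl.trans (Eq.trans (tprod_congr fun p => ?_) hr.symm)
  by_cases hp : p.Prime
  · by_cases h2 : p = 2
    · subst h2
      simp [tsum_oddWeight_pow k hp, hp]
    · rw [Set.mulIndicator_of_mem (s := {p : ℕ | p.Prime}) hp,
        Set.mulIndicator_of_mem (s := {p : ℕ | p.Prime ∧ p ≠ 2}) ⟨hp, h2⟩,
        tsum_oddWeight_pow k hp, if_neg h2, discWeight_prime k hp, localWeight,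
        Real.rpow_neg (by positivity), inv_mul_eq_div, div_div, mul_comm ((p : ℝ) ^ k)]
  · simp [hp]

lemma natAbs_le_natAbs_quadDisc (r : ℤ) : r.natAbs ≤ (quadDisc r).natAbs := by
  unfold quadDisc
  split_ifs <;> omega

lemma fieldWeight_nonneg (k : ℝ) (r : ℤ) : 0 ≤ fieldWeight k r := by
  unfold fieldWeight
  split_ifs
  exacts [discWeight_nonneg k _, le_rfl]

lemma fieldWeight_le {k : ℝ} (hk : 0 ≤ k) (r : ℤ) : fieldWeight k r ≤ (r.natAbs : ℝ) ^ (-k) := by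
  unfold fieldWeight
  split_ifs with h
  · have hr : 0 < r.natAbs := Int.natAbs_pos.mpr h.ne_zero
    exact (discWeight_le k _).trans (Real.rpow_le_rpow_of_nonpos (by exact_mod_cast hr)
      (by exact_mod_cast natAbs_le_natAbs_quadDisc r) (neg_nonpos.mpr hk))
  · positivity

lemma summable_fieldWeight_natCast {k : ℝ} (hk : 1 < k) :
    Summable fun n : ℕ => fieldWeight k n :=
  Summable.of_nonneg_of_le (fun n => fieldWeight_nonneg k n)
    (fun n => by simpa using fieldWeight_le (by linarith) (n : ℤ))
    (Real.summable_nat_rpow.mpr (neg_lt_neg hk))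

lemma summable_fieldWeight_neg_natCast {k : ℝ} (hk : 1 < k) :
    Summable fun n : ℕ => fieldWeight k (-n) :=
  Summable.of_nonneg_of_le (fun n => fieldWeight_nonneg k _)
    (fun n => by simpa using fieldWeight_le (by linarith) (-n : ℤ))
    (Real.summable_nat_rpow.mpr (neg_lt_neg hk))

lemma squarefree_neg_natCast (n : ℕ) : Squarefree (-(n : ℤ)) ↔ Squarefree n := by
  rw [← Int.squarefree_natAbs, Int.natAbs_neg, Int.natAbs_natCast]

lemma fieldWeight_add_neg_of_odd (k : ℝ) {n : ℕ} (hn : Odd n) :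
    fieldWeight k n + fieldWeight k (-n) = (1 + discWeight k 4) * oddWeight k n := by
  have h4 : (4 : ℕ).Coprime n := Nat.Coprime.pow_left 2 (Nat.coprime_two_left.mpr hn)
  simp only [fieldWeight, oddWeight, squarefree_neg_natCast, Int.squarefree_natCast, hn, true_and]
  split_ifs with h
  · rw [Nat.odd_iff] at hn
    rcases (by omega : (n : ℤ) % 4 = 1 ∨ (n : ℤ) % 4 = 3) with h1 | h3
    · have ha : (quadDisc n).natAbs = n := by
        rw [quadDisc, if_pos h1]; omega
      have hb : (quadDisc (-n)).natAbs = 4 * n := by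
        rw [quadDisc, if_neg (by omega)]; omega
      rw [ha, hb, discWeight_mul k h4]
      ring
    · have ha : (quadDisc n).natAbs = 4 * n := by
        rw [quadDisc, if_neg (by omega)]; omega
      have hb : (quadDisc (-n)).natAbs = n := by
        rw [quadDisc, if_pos (by omega)]; omega
      rw [ha, hb, discWeight_mul k h4]
      ring
  · ring

lemma fieldWeight_add_neg_two_mul (k : ℝ) (m : ℕ) :
    fieldWeight k (2 * m : ℕ) + fieldWeight k (-(2 * m : ℕ)) =
      2 * discWeight k 8 * oddWeight k m := by
  have hodd : Squarefree (2 * m) ↔ Odd m ∧ Squarefree m := by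
    rw [Nat.squarefree_mul_iff, Nat.coprime_two_left]
    simp [Nat.prime_two.prime.squarefree]
  simp only [fieldWeight, oddWeight, squarefree_neg_natCast, Int.squarefree_natCast, hodd]
  split_ifs with h
  · have h8 : (8 : ℕ).Coprime m := Nat.Coprime.pow_left 3 (Nat.coprime_two_left.mpr h.1)
    have ha : (quadDisc (2 * m : ℕ)).natAbs = 8 * m := by
      rw [quadDisc, if_neg (by omega)]; omega
    have hb : (quadDisc (-(2 * m : ℕ))).natAbs = 8 * m := by
      rw [quadDisc, if_neg (by omega)]; omega
    rw [ha, hb, discWeight_mul k h8]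
    ring
  · ring

lemma hasSum_fieldWeight_add_neg {k : ℝ} (hk : 1 < k) :
    HasSum (fun n : ℕ => fieldWeight k n + fieldWeight k (-n))
      ((1 + discWeight k 4 + 2 * discWeight k 8) * ∑' n, oddWeight k n) := by
  have hsum := (summable_oddWeight hk).hasSum
  have hinj : Function.Injective fun m : ℕ => 2 * m := fun a b h => by
    simpa using h
  have heven : HasSum (fun n : ℕ => if Even n then fieldWeight k n + fieldWeight k (-n) else 0)
      (2 * discWeight k 8 * ∑' n, oddWeight k n) := by
    rw [← hinj.hasSum_iff fun n hn => if_neg fun h => hn ?_]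
    · refine (hsum.mul_left _).congr_fun fun m => ?_
      simp only [Function.comp_apply, even_two_mul, if_true, fieldWeight_add_neg_two_mul]
    · obtain ⟨m, rfl⟩ := h.two_dvd
      exact ⟨m, rfl⟩
  rw [add_mul]
  refine ((hsum.mul_left _).add heven).congr_fun fun n => ?_
  rcases Nat.even_or_odd n with h | h
  · simp [h, oddWeight, Nat.not_odd_iff_even.mpr h]
  · simp [Nat.not_even_iff_odd.mpr h, fieldWeight_add_neg_of_odd k h]

lemma hasSum_fieldWeight {k : ℝ} (hk : 1 < k) :
    HasSum (fieldWeight k)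
      ((1 + discWeight k 4 + 2 * discWeight k 8) * ∑' n, oddWeight k n) := by
  have hpos := summable_fieldWeight_natCast hk
  have hneg := summable_fieldWeight_neg_natCast hk
  have h := hpos.hasSum.of_nat_of_neg hneg.hasSum
  rwa [← hpos.tsum_add hneg, (hasSum_fieldWeight_add_neg hk).tsum_eq,
    show fieldWeight k 0 = 0 by simp [fieldWeight], sub_zero] at h

theorem stmt_4 (k : ℝ) (hk : 1 < k) :
    ∑' r : {r : ℤ // Squarefree r ∧ r ≠ 0 ∧ r ≠ 1},
        (|quadDisc r.1| : ℝ) ^ (-k) *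
          ∏ p ∈ (quadDisc r.1).natAbs.primeFactors, ((p : ℝ) + 1) / ((p : ℝ) ^ 2 + p + 1)
      = (1 + 3 / (7 * (4 : ℝ) ^ k) + 6 / (7 * (8 : ℝ) ^ k)) *
          (∏' p : {p : ℕ // p.Prime ∧ p ≠ 2},
            (1 + ((p : ℝ) + 1) / ((p : ℝ) ^ k * ((p : ℝ) ^ 2 + p + 1))))
        - 1 := by
  have hone : fieldWeight k 1 = 1 := by simp [fieldWeight, quadDisc, discWeight_one]
  have hsum := (hasSum_fieldWeight hk).sub (hasSum_ite_eq (1 : ℤ) (1 : ℝ))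
  have hsub := tsum_subtype {r : ℤ | Squarefree r ∧ r ≠ 0 ∧ r ≠ 1} fun r =>
    (|quadDisc r| : ℝ) ^ (-k) *
      ∏ p ∈ (quadDisc r).natAbs.primeFactors, ((p : ℝ) + 1) / ((p : ℝ) ^ 2 + p + 1)
  rw [← tsum_oddWeight hk, ← discWeight_four,
    show 6 / (7 * (8 : ℝ) ^ k) = 2 * discWeight k 8 by rw [discWeight_eight]; ring,
    ← hsum.tsum_eq]
  refine hsub.trans (tsum_congr fun r => ?_)
  by_cases h1 : r = 1
  · simp [h1, hone]
  · by_cases hr : Squarefree r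
    · rw [Set.indicator_of_mem (s := {r : ℤ | Squarefree r ∧ r ≠ 0 ∧ r ≠ 1})
        ⟨hr, hr.ne_zero, h1⟩, fieldWeight, if_pos hr, if_neg h1, sub_zero, discWeight,
        Nat.cast_natAbs, Int.cast_abs]
      rfl
    · simp [hr, h1, fieldWeight]
end
end

section
/- Let 𝒜 be the set of integers n ≥ 2 such that every exponent in the prime factorization of n equals 1 or 3. Then #{n ∈ 𝒜 : n ≤ X} = C₀·X + O(√X) as X → ∞, where C₀ = (6/π²)·∏_{p prime} (1 + 1/(p²(p+1))). -/
/- STATEMENT 15: Let 𝒜 be the set of integers n ≥ 2 all of whose prime-factorization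
exponents are 1 or 3. Then #{n ∈ 𝒜 : n ≤ X} = C₀·X + O(√X), where
C₀ = (6/π²)·∏_p (1 + 1/(p²(p+1))). -/

open scoped Classical
open Filter
noncomputable section

/-- `n ∈ 𝒜`: integers `n ≥ 2` such that every exponent in the prime factorization of `n`
equals 1 or 3. -/
def memA (n : ℕ) : Prop :=
  2 ≤ n ∧ ∀ p : ℕ, p.Prime → p ∣ n → n.factorization p = 1 ∨ n.factorization p = 3

/-- The constant `C₀ = (6/π²)·∏_p (1 + 1/(p²(p+1)))`. -/
noncomputable def C0 : ℝ :=
  6 / Real.pi ^ 2 * ∏' p : Nat.Primes, (1 + 1 / ((p : ℝ) ^ 2 * ((p : ℝ) + 1)))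

/-- The indicator function of the positive integers all of whose exponents are `1` or `3`. -/
def indA : ArithmeticFunction ℝ where
  toFun n := if n ≠ 0 ∧ ∀ p : ℕ, p.Prime → p ∣ n → n.factorization p = 1 ∨ n.factorization p = 3
    then 1 else 0
  map_zero' := by simp

open scoped ArithmeticFunction.Moebius ArithmeticFunction.zeta

/-- The Dirichlet convolution of `indA` with the Möbius function. -/
def moebiusA : ArithmeticFunction ℝ := indA * (μ : ArithmeticFunction ℝ)

theorem moebiusA_mul_zeta : moebiusA * (ζ : ArithmeticFunction ℝ) = indA := by
  rw [moebiusA, mul_assoc, ArithmeticFunction.coe_moebius_mul_coe_zeta, mul_one]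

theorem indA_apply (n : ℕ) : indA n =
    if n ≠ 0 ∧ ∀ p : ℕ, p.Prime → p ∣ n → n.factorization p = 1 ∨ n.factorization p = 3
    then 1 else 0 := rfl

theorem indA_isMultiplicative : indA.IsMultiplicative := by
  rw [ArithmeticFunction.IsMultiplicative.iff_ne_zero]
  refine ⟨?_, ?_⟩
  · rw [indA_apply, if_pos]
    refine ⟨one_ne_zero, fun p hp h => ?_⟩
    exact absurd (Nat.dvd_one.1 h) hp.ne_one
  · intro m n hm hn hmn
    have key : (m * n ≠ 0 ∧ ∀ p : ℕ, p.Prime → p ∣ m * n →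
        (m * n).factorization p = 1 ∨ (m * n).factorization p = 3) ↔
        (m ≠ 0 ∧ ∀ p : ℕ, p.Prime → p ∣ m → m.factorization p = 1 ∨ m.factorization p = 3) ∧
        (n ≠ 0 ∧ ∀ p : ℕ, p.Prime → p ∣ n → n.factorization p = 1 ∨ n.factorization p = 3) := by
      have hl : ∀ p : ℕ, p.Prime → p ∣ m → (m * n).factorization p = m.factorization p := by
        intro p hp h
        rw [Nat.factorization_mul hm hn, Finsupp.add_apply,
          Nat.factorization_eq_zero_of_not_dvd (n := n), add_zero]
        exact fun h' => hp.ne_one (Nat.eq_one_of_dvd_coprimes hmn h h')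
      have hr : ∀ p : ℕ, p.Prime → p ∣ n → (m * n).factorization p = n.factorization p := by
        intro p hp h
        rw [Nat.factorization_mul hm hn, Finsupp.add_apply,
          Nat.factorization_eq_zero_of_not_dvd (n := m), zero_add]
        exact fun h' => hp.ne_one (Nat.eq_one_of_dvd_coprimes hmn h' h)
      constructor
      · rintro ⟨-, h⟩
        exact ⟨⟨hm, fun p hp hd => hl p hp hd ▸ h p hp (hd.mul_right _)⟩,
          ⟨hn, fun p hp hd => hr p hp hd ▸ h p hp (hd.mul_left _)⟩⟩
      · rintro ⟨⟨-, h1⟩, ⟨-, h2⟩⟩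
        refine ⟨mul_ne_zero hm hn, fun p hp hd => ?_⟩
        rcases hp.dvd_mul.1 hd with h | h
        · rw [hl p hp h]; exact h1 p hp h
        · rw [hr p hp h]; exact h2 p hp h
    simp only [indA_apply, key]
    split_ifs <;> simp_all

theorem moebiusA_isMultiplicative : moebiusA.IsMultiplicative :=
  indA_isMultiplicative.mul ArithmeticFunction.isMultiplicative_moebius.intCast

theorem indA_prime_pow {p : ℕ} (hp : p.Prime) (k : ℕ) :
    indA (p ^ k) = if k = 0 ∨ k = 1 ∨ k = 3 then 1 else 0 := by
  rw [indA_apply]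
  congr 1
  rw [eq_iff_iff]
  constructor
  · rintro ⟨-, h⟩
    by_cases hk : k = 0
    · exact Or.inl hk
    · have := h p hp (dvd_pow_self p hk)
      rw [hp.factorization_pow] at this
      simpa [hk] using this
  · intro h
    refine ⟨pow_ne_zero _ hp.ne_zero, fun q hq hd => ?_⟩
    have hqp := (Nat.prime_dvd_prime_iff_eq hq hp).1 (hq.dvd_of_dvd_pow hd)
    subst hqp
    rcases h with rfl | h
    · exact absurd (Nat.dvd_one.1 hd) hq.ne_one
    · rw [hq.factorization_pow]; simpa using h

theorem moebiusA_prime_pow_succ {p : ℕ} (hp : p.Prime) (k : ℕ) :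
    moebiusA (p ^ (k + 1)) = indA (p ^ (k + 1)) - indA (p ^ k) := by
  have h (j : ℕ) : indA (p ^ j) = ∑ i ∈ Finset.range (j + 1), moebiusA (p ^ i) := by
    rw [← moebiusA_mul_zeta, ArithmeticFunction.coe_mul_zeta_apply,
      Nat.sum_divisors_prime_pow hp]
  rw [h, h, Finset.sum_range_succ _ (k + 1)]
  ring

theorem moebiusA_prime_pow {p : ℕ} (hp : p.Prime) (k : ℕ) :
    moebiusA (p ^ k) = if k = 0 ∨ k = 3 then 1 else if k = 2 ∨ k = 4 then -1 else 0 := by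
  rcases k with _ | k
  · simpa using moebiusA_isMultiplicative.map_one
  · rw [moebiusA_prime_pow_succ hp, indA_prime_pow hp, indA_prime_pow hp]
    rcases k with _ | _ | _ | _ | k <;> simp

theorem moebiusA_bound (n : ℕ) : |moebiusA n| ≤ 1 ∧
    (moebiusA n ≠ 0 → ∃ a b : ℕ, n = a ^ 2 * b ^ 3) := by
  induction n using Nat.recOnPosPrimePosCoprime with
  | zero => simp
  | one => exact ⟨by simp [moebiusA_isMultiplicative.map_one], fun _ => ⟨1, 1, by simp⟩⟩
  | prime_pow p k hp hk =>
    rw [moebiusA_prime_pow hp]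
    refine ⟨by split_ifs <;> simp, fun h => ?_⟩
    have : k = 3 ∨ k = 2 ∨ k = 4 := by
      by_contra h'
      apply h
      rw [if_neg (by omega), if_neg (by omega)]
    rcases this with rfl | rfl | rfl
    · exact ⟨1, p, by ring⟩
    · exact ⟨p, 1, by ring⟩
    · exact ⟨p ^ 2, 1, by ring⟩
  | coprime m n hm hn hmn ihm ihn =>
    rw [moebiusA_isMultiplicative.map_mul_of_coprime hmn]
    refine ⟨?_, fun h => ?_⟩
    · rw [abs_mul]; exact mul_le_one₀ ihm.1 (abs_nonneg _) ihn.1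
    · obtain ⟨a, b, hab⟩ := ihm.2 (left_ne_zero_of_mul h)
      obtain ⟨c, d, hcd⟩ := ihn.2 (right_ne_zero_of_mul h)
      exact ⟨a * c, b * d, by rw [hab, hcd]; ring⟩

theorem sum_range_min_one_sq_le {t : ℝ} (ht : 0 < t) (N : ℕ) :
    ∑ a ∈ Finset.range N, min 1 ((t / (a + 1)) ^ 2) ≤ 4 * t := by
  have key : ∑ a ∈ Finset.range N, min 1 ((t / (a + 1)) ^ 2) ≤ 4 * t - 4 * t ^ 2 / (t + N) := by
    induction N with
    | zero => simp; field_simp; simp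
    | succ N ih =>
      rw [Finset.sum_range_succ]
      have hN : (0 : ℝ) ≤ N := N.cast_nonneg
      have h1 : 4 * t ^ 2 / (t + N) - 4 * t ^ 2 / (t + (N + 1)) =
          4 * t ^ 2 / ((t + N) * (t + (N + 1))) := by
        field_simp; ring
      have h2 : min 1 ((t / (N + 1 : ℝ)) ^ 2) ≤ 4 * t ^ 2 / ((t + N) * (t + (N + 1))) := by
        rcases le_total t (N + 1) with h | h
        · refine (min_le_right _ _).trans ?_
          rw [div_pow, div_le_div_iff₀ (by positivity) (by positivity)]
          have : (t + N) * (t + (N + 1)) ≤ 4 * (N + 1 : ℝ) ^ 2 := by nlinarith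
          nlinarith [mul_le_mul_of_nonneg_left this (sq_nonneg t)]
        · refine (min_le_left _ _).trans ?_
          rw [le_div_iff₀ (by positivity)]
          nlinarith
      push_cast
      linarith
  have : 0 ≤ 4 * t ^ 2 / (t + N) := by positivity
  linarith

theorem exists_sum_le_sqrt : ∃ C : ℝ, ∀ X : ℝ, 0 < X →
    Summable (fun x : ℕ × ℕ => min 1 (X / ((x.1 + 1 : ℝ) ^ 3 * (x.2 + 1) ^ 2))) ∧
    ∑' x : ℕ × ℕ, min 1 (X / ((x.1 + 1 : ℝ) ^ 3 * (x.2 + 1) ^ 2)) ≤ C * √X := by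
  have hb : Summable fun b : ℕ => 1 / √((b + 1 : ℝ) ^ 3) := by
    have := (summable_nat_add_iff 1).2 (Real.summable_one_div_nat_rpow.2 (by norm_num : (1 : ℝ) < 3 / 2))
    refine this.congr fun b => ?_
    congr 1
    rw [Real.sqrt_eq_rpow, ← Real.rpow_natCast, ← Real.rpow_mul (by positivity)]
    push_cast
    norm_num
  refine ⟨4 * ∑' b : ℕ, 1 / √((b + 1 : ℝ) ^ 3), fun X hX => ?_⟩
  have hnn : ∀ x : ℕ × ℕ, 0 ≤ min 1 (X / ((x.1 + 1 : ℝ) ^ 3 * (x.2 + 1) ^ 2)) :=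
    fun x => le_min zero_le_one (by positivity)
  have hin (b N : ℕ) : ∑ a ∈ Finset.range N, min 1 (X / ((b + 1 : ℝ) ^ 3 * (a + 1) ^ 2)) ≤
      4 * √X * (1 / √((b + 1 : ℝ) ^ 3)) := by
    have := sum_range_min_one_sq_le (t := √X / √((b + 1 : ℝ) ^ 3)) (by positivity) N
    refine le_trans (le_of_eq ?_) (this.trans_eq (by ring))
    refine Finset.sum_congr rfl fun a _ => ?_
    rw [div_pow, div_pow, Real.sq_sqrt hX.le, Real.sq_sqrt (by positivity), div_div]
  have hsum : ∀ b : ℕ, Summable fun a : ℕ => min 1 (X / ((b + 1 : ℝ) ^ 3 * (a + 1) ^ 2)) :=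
    fun b => summable_of_sum_range_le (fun a => hnn (b, a)) (hin b)
  have hle : ∀ b : ℕ, ∑' a : ℕ, min 1 (X / ((b + 1 : ℝ) ^ 3 * (a + 1) ^ 2)) ≤
      4 * √X * (1 / √((b + 1 : ℝ) ^ 3)) :=
    fun b => Real.tsum_le_of_sum_range_le (fun a => hnn (b, a)) (hin b)
  have hout : Summable fun b : ℕ => ∑' a : ℕ, min 1 (X / ((b + 1 : ℝ) ^ 3 * (a + 1) ^ 2)) :=
    Summable.of_nonneg_of_le (fun b => tsum_nonneg fun a => hnn (b, a)) hle (hb.mul_left _)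
  have hs := (summable_prod_of_nonneg (f := fun x : ℕ × ℕ =>
    min 1 (X / ((x.1 + 1 : ℝ) ^ 3 * (x.2 + 1) ^ 2))) hnn).2 ⟨hsum, hout⟩
  refine ⟨hs, ?_⟩
  rw [hs.tsum_prod]
  refine (hout.tsum_le_tsum hle (hb.mul_left _)).trans_eq ?_
  rw [tsum_mul_left]
  ring

theorem exists_tsum_moebiusA_le : ∃ C : ℝ, ∀ X : ℝ, 0 < X →
    Summable (fun d : ℕ => |moebiusA d| * min 1 (X / d)) ∧
    ∑' d : ℕ, |moebiusA d| * min 1 (X / d) ≤ C * √X := by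
  obtain ⟨C, hC⟩ := exists_sum_le_sqrt
  have hex : ∀ d : Function.support moebiusA,
      ∃ x : ℕ × ℕ, (d : ℕ) = (x.1 + 1) ^ 3 * (x.2 + 1) ^ 2 := by
    rintro ⟨d, hd⟩
    obtain ⟨a, b, rfl⟩ := (moebiusA_bound d).2 hd
    rcases a with _ | a
    · simp at hd
    rcases b with _ | b
    · simp at hd
    exact ⟨(b, a), mul_comm _ _⟩
  choose φ hφ using hex
  have hinj : Function.Injective φ := fun d e h => Subtype.ext (by rw [hφ, hφ, h])
  refine ⟨C, fun X hX => ?_⟩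
  obtain ⟨hs, hle⟩ := hC X hX
  have hnn : ∀ d : ℕ, 0 ≤ |moebiusA d| * min 1 (X / d) :=
    fun d => mul_nonneg (abs_nonneg _) (le_min zero_le_one (by positivity))
  have hsupp : Function.support (fun d : ℕ => |moebiusA d| * min 1 (X / d)) ⊆
      Function.support moebiusA := fun d hd h => hd (by simp [h])
  have hcomp : ∀ d : Function.support moebiusA, |moebiusA d| * min 1 (X / (d : ℕ)) ≤
      min 1 (X / (((φ d).1 + 1 : ℝ) ^ 3 * ((φ d).2 + 1) ^ 2)) := by
    intro d
    have : ((d : ℕ) : ℝ) = ((φ d).1 + 1 : ℝ) ^ 3 * ((φ d).2 + 1) ^ 2 := by exact_mod_cast hφ d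
    rw [this]
    exact mul_le_of_le_one_left (le_min zero_le_one (by positivity)) (moebiusA_bound d).1
  have hsφ : Summable fun d : Function.support moebiusA =>
      min 1 (X / (((φ d).1 + 1 : ℝ) ^ 3 * ((φ d).2 + 1) ^ 2)) := hs.comp_injective hinj
  have hs' : Summable fun d : Function.support moebiusA =>
      |moebiusA d| * min 1 (X / (d : ℕ)) :=
    Summable.of_nonneg_of_le (fun d => hnn d) hcomp hsφ
  refine ⟨?_, ?_⟩
  · have := (summable_subtype_iff_indicator
      (f := fun d : ℕ => |moebiusA d| * min 1 (X / d))).1 hs'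
    rwa [Set.indicator_eq_self.2 hsupp] at this
  · rw [← tsum_subtype_eq_of_support_subset hsupp]
    refine le_trans ?_ hle
    refine Summable.tsum_le_tsum_of_inj φ hinj ?_ hcomp hs' hs
    exact fun x _ => le_min zero_le_one (by positivity)

theorem summable_abs_moebiusA_div : Summable fun d : ℕ => ‖moebiusA d / d‖ := by
  obtain ⟨C, hC⟩ := exists_tsum_moebiusA_le
  refine (hC 1 one_pos).1.congr fun d => ?_
  rcases Nat.eq_zero_or_pos d with rfl | hd
  · simp
  · have : (1 : ℝ) ≤ d := by exact_mod_cast hd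
    rw [min_eq_right ((div_le_one (by positivity)).2 this), norm_div, Real.norm_eq_abs,
      Real.norm_eq_abs, Nat.abs_cast]
    ring

theorem hasProd_zeta_two :
    HasProd (fun p : Nat.Primes => (1 - 1 / (p : ℝ) ^ 2)⁻¹) (Real.pi ^ 2 / 6) := by
  let f : ℕ →*₀ ℝ :=
    { toFun := fun n => 1 / (n : ℝ) ^ 2
      map_zero' := by simp
      map_one' := by simp
      map_mul' := fun m n => by push_cast; rw [mul_pow]; field_simp }
  have h := EulerProduct.eulerProduct_completely_multiplicative_hasProd (f := f)
    hasSum_zeta_two.summable.norm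
  rwa [show ∑' n, f n = _ from hasSum_zeta_two.tsum_eq] at h

theorem tsum_moebiusA_prime_pow_div {p : ℕ} (hp : p.Prime) :
    ∑' e : ℕ, moebiusA (p ^ e) / ((p ^ e : ℕ) : ℝ) =
      (1 - 1 / (p : ℝ) ^ 2) * (1 + 1 / ((p : ℝ) ^ 2 * ((p : ℝ) + 1))) := by
  have hp0 : (0 : ℝ) < p := by exact_mod_cast hp.pos
  rw [tsum_eq_sum (s := Finset.range 5)]
  · simp only [Finset.sum_range_succ, moebiusA_prime_pow hp]
    norm_num
    field_simp
    ring
  · intro e he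
    rw [Finset.mem_range] at he
    rw [moebiusA_prime_pow hp, if_neg (by omega), if_neg (by omega), zero_div]

theorem tsum_moebiusA_div : ∑' d : ℕ, moebiusA d / d = C0 := by
  have h := EulerProduct.eulerProduct_hasProd (f := fun d : ℕ => moebiusA d / d)
    (by simp [moebiusA_isMultiplicative.map_one])
    (fun {m n} hmn => by
      simp only [moebiusA_isMultiplicative.map_mul_of_coprime hmn, Nat.cast_mul]
      rw [mul_div_mul_comm])
    summable_abs_moebiusA_div (by simp)
  have h2 := (h.mul hasProd_zeta_two).tprod_eq
  have h3 : ∀ p : Nat.Primes, (∑' e : ℕ, moebiusA ((p : ℕ) ^ e) / (((p : ℕ) ^ e : ℕ) : ℝ)) *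
      (1 - 1 / (p : ℝ) ^ 2)⁻¹ = 1 + 1 / ((p : ℝ) ^ 2 * ((p : ℝ) + 1)) := by
    intro p
    rw [tsum_moebiusA_prime_pow_div p.2]
    have hp1 : (1 : ℝ) < p := by exact_mod_cast p.2.one_lt
    have : (1 - 1 / (p : ℝ) ^ 2) ≠ 0 := by
      rw [sub_ne_zero, ne_comm]
      exact ((div_lt_one (by positivity)).2 (one_lt_pow₀ hp1 two_ne_zero)).ne
    rw [mul_right_comm, mul_inv_cancel₀ this, one_mul]
  rw [tprod_congr h3] at h2
  rw [C0, h2]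
  have := Real.pi_pos
  field_simp

theorem card_memA {X : ℝ} (hX : 1 ≤ X) :
    (Nat.card {n : ℕ // memA n ∧ (n : ℝ) ≤ X} : ℝ) =
      ∑ n ∈ Finset.Ioc 0 ⌊X⌋₊, indA n - 1 := by
  have h1 : Nat.card {n : ℕ // memA n ∧ (n : ℝ) ≤ X} =
      ((Finset.Ioc 1 ⌊X⌋₊).filter memA).card := by
    refine Nat.subtype_card _ fun n => ?_
    rw [Finset.mem_filter, Finset.mem_Ioc, Nat.le_floor_iff (by linarith)]
    exact ⟨fun h => ⟨h.2, h.1.2⟩, fun h => ⟨⟨h.1.1, h.2⟩, h.1⟩⟩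
  have hN : 1 ≤ ⌊X⌋₊ := Nat.le_floor (by simpa using hX)
  rw [h1, ← Finset.sum_Ioc_consecutive _ zero_le_one hN, Finset.card_filter]
  have h2 : ∑ n ∈ Finset.Ioc 0 1, indA n = 1 := by
    simpa using indA_isMultiplicative.map_one
  rw [h2, Nat.cast_sum, add_sub_cancel_left]
  refine Finset.sum_congr rfl fun n hn => ?_
  have hn1 := (Finset.mem_Ioc.1 hn).1
  have : memA n ↔ (n ≠ 0 ∧ ∀ p : ℕ, p.Prime → p ∣ n →
      n.factorization p = 1 ∨ n.factorization p = 3) :=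
    and_congr_left fun _ => by omega
  rw [indA_apply]
  simp only [this]
  push_cast
  rfl

theorem sum_indA (X : ℝ) :
    HasSum (fun d : ℕ => moebiusA d * ⌊X / d⌋₊) (∑ n ∈ Finset.Ioc 0 ⌊X⌋₊, indA n) := by
  rw [← moebiusA_mul_zeta, ArithmeticFunction.sum_Ioc_mul_zeta_eq_sum]
  simp_rw [Nat.floor_div_natCast]
  refine hasSum_sum_of_ne_finset_zero fun d hd => ?_
  rcases Nat.eq_zero_or_pos d with rfl | hd0
  · simp
  · rw [Nat.div_eq_of_lt, Nat.cast_zero, mul_zero]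
    simp only [Finset.mem_Ioc] at hd
    omega

theorem abs_floor_sub_le {x : ℝ} (hx : 0 ≤ x) : |(⌊x⌋₊ : ℝ) - x| ≤ min 1 x := by
  have h1 := Nat.floor_le hx
  have h2 := Nat.lt_floor_add_one x
  have h3 : (0 : ℝ) ≤ ⌊x⌋₊ := Nat.cast_nonneg _
  rw [abs_sub_comm, abs_of_nonneg (by linarith)]
  exact le_min (by linarith) (by linarith)

theorem stmt_15 :
    (fun X : ℝ => (Nat.card {n : ℕ // memA n ∧ (n : ℝ) ≤ X} : ℝ) - C0 * X)
      =O[atTop] fun X : ℝ => Real.sqrt X := by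
  obtain ⟨C, hC⟩ := exists_tsum_moebiusA_le
  refine Asymptotics.IsBigO.of_bound (C + 1) ?_
  filter_upwards [eventually_ge_atTop 1] with X hX
  obtain ⟨hs, hle⟩ := hC X (by linarith)
  have hC0 : HasSum (fun d : ℕ => moebiusA d * (X / d)) (C0 * X) := by
    rw [← tsum_moebiusA_div]
    refine (summable_abs_moebiusA_div.of_norm.hasSum.mul_right X).congr_fun fun d => ?_
    ring
  have hdiff := (sum_indA X).sub hC0
  have hb : ‖∑ n ∈ Finset.Ioc 0 ⌊X⌋₊, indA n - C0 * X‖ ≤ C * √X := by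
    rw [← hdiff.tsum_eq]
    refine (tsum_of_norm_bounded hs.hasSum fun d => ?_).trans hle
    rw [← mul_sub, norm_mul]
    exact mul_le_mul_of_nonneg_left (abs_floor_sub_le (by positivity)) (abs_nonneg _)
  rw [card_memA hX, Real.norm_of_nonneg (Real.sqrt_nonneg X)]
  have h1 : 1 ≤ √X := Real.one_le_sqrt.2 hX
  rw [Real.norm_eq_abs, abs_le] at *
  constructor <;> linarith [hb.1, hb.2]
end
end
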